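/- arXiv:2403.13426 — 2 statements merged into one kernel-verified Lean document; each statement's English description precedes it below -/
import Mathlib

section
/- Let n ≥ 3 be an integer, let h satisfy hypotheses (H), let k ≥ 1 be an integer, and suppose there exist C2 > C1 > 0 and 0 < R1 < R such that h(r) ≤ C2 for all 0 ≤ r ≤ R and h(r) ≥ C1 for all 0 ≤ r ≤ R1. Suppose γ > 0 satisfies γ ≤ 1/(4 R1 ρ), suppose σ_(k+1)(g_h)/σ_(k)(g_h) ≥ λ_(k+1)/λ_(k) − γ, and let a_k be a minimizer for σ_(k)(g_h) normalized so that a_k(0) = 1. Then 1/2 ≤ a_k(r) ≤ 3/2 for all r ∈ (0, R1]. -/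
open MeasureTheory Set

/-- Hypotheses (H): `h` is smooth on `[0,R]`, positive on `[0,R)`, `h(R)=0`,
`h'(R) = -1`, and all even-order derivatives of `h` vanish at `R`. -/
def SatisfiesH (R : ℝ) (h : ℝ → ℝ) : Prop :=
  ContDiffOn ℝ (⊤ : ℕ∞) h (Set.Icc 0 R) ∧
  (∀ r ∈ Set.Ico (0:ℝ) R, 0 < h r) ∧
  h R = 0 ∧
  derivWithin h (Set.Icc 0 R) R = -1 ∧
  ∀ k : ℕ, iteratedDerivWithin (2 * k) h (Set.Icc 0 R) R = 0

/-- The `k`-th distinct eigenvalue `λ_(k) = k (n + k - 2)` of the Laplacian on the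
round unit sphere `S^{n-1}`. -/
noncomputable def sphereEig (n k : ℕ) : ℝ := (k : ℝ) * ((n : ℝ) + (k : ℝ) - 2)

/-- The Rayleigh quotient
`R_λ(a; h) = (∫₀^R ((a')² h^{n-1} + λ a² h^{n-3}))/(a(0)² h(0)^{n-1})`. -/
noncomputable def rayleighQ (R : ℝ) (n : ℕ) (lam : ℝ) (h a : ℝ → ℝ) : ℝ :=
  (∫ r in (0:ℝ)..R,
      (deriv a r) ^ 2 * h r ^ ((n : ℤ) - 1) + lam * (a r) ^ 2 * h r ^ ((n : ℤ) - 3)) /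
    ((a 0) ^ 2 * h 0 ^ ((n : ℤ) - 1))

/-- Admissible test functions: Lipschitz on `[0,R]`, vanishing at `R`, nonzero at `0`. -/
def IsAdmissible (R : ℝ) (a : ℝ → ℝ) : Prop :=
  (∃ K : NNReal, LipschitzOnWith K a (Set.Icc 0 R)) ∧ a R = 0 ∧ a 0 ≠ 0

/-- The `k`-th distinct Steklov eigenvalue of the ball `[0,R] × S^{n-1}` with the
revolution metric `g_h`, characterized variationally. -/
noncomputable def steklov (R : ℝ) (n k : ℕ) (h : ℝ → ℝ) : ℝ :=
  sInf { v : ℝ | ∃ a : ℝ → ℝ, IsAdmissible R a ∧ v = rayleighQ R n (sphereEig n k) h a }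

/-- `a` is a minimizer realizing `σ_(k)(g_h)`. -/
def IsMinimizer (R : ℝ) (n k : ℕ) (h a : ℝ → ℝ) : Prop :=
  IsAdmissible R a ∧ rayleighQ R n (sphereEig n k) h a = steklov R n k h

lemma aux_ii_deriv (R : ℝ) (a : ℝ → ℝ) (K : NNReal) (hR : 0 < R)
    (hL : LipschitzOnWith K a (Set.Icc 0 R)) (g : ℝ → ℝ) (hg : ContinuousOn g (Set.Icc 0 R)) :
    IntervalIntegrable (fun r => (deriv a r) ^ 2 * g r) volume 0 R := by
  have hg' : IntervalIntegrable g volume 0 R := by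
    apply ContinuousOn.intervalIntegrable
    rwa [Set.uIcc_of_le hR.le]
  rw [intervalIntegrable_iff_integrableOn_Ioo_of_le hR.le] at hg' ⊢
  refine Integrable.bdd_mul (c := (K:ℝ)^2) hg' ((measurable_deriv a).pow_const 2).aestronglyMeasurable ?_
  refine (ae_restrict_iff' measurableSet_Ioo).2 (Filter.Eventually.of_forall fun r hr => ?_)
  have := norm_deriv_le_of_lipschitzOn (Icc_mem_nhds hr.1 hr.2) hL
  rw [norm_pow]
  gcongr

lemma aux_ii_sq (R : ℝ) (a : ℝ → ℝ) (K : NNReal) (hR : 0 < R)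
    (hL : LipschitzOnWith K a (Set.Icc 0 R)) (g : ℝ → ℝ) (hg : ContinuousOn g (Set.Icc 0 R)) :
    IntervalIntegrable (fun r => (a r) ^ 2 * g r) volume 0 R := by
  apply ContinuousOn.intervalIntegrable
  rw [Set.uIcc_of_le hR.le]
  exact (hL.continuousOn.pow 2).mul hg

lemma aux_rq (R : ℝ) (m : ℕ) (lam : ℝ) (h a : ℝ → ℝ) (K : NNReal) (hR : 0 < R)
    (hL : LipschitzOnWith K a (Set.Icc 0 R)) (hh : ContinuousOn h (Set.Icc 0 R)) :
    rayleighQ R (m + 3) lam h a =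
      ((∫ r in (0:ℝ)..R, (deriv a r) ^ 2 * h r ^ (m + 2)) +
        lam * ∫ r in (0:ℝ)..R, (a r) ^ 2 * h r ^ m) / ((a 0) ^ 2 * h 0 ^ (m + 2)) := by
  have e1 : (((m + 3 : ℕ) : ℤ) - 1) = ((m + 2 : ℕ) : ℤ) := by push_cast; ring
  have e2 : (((m + 3 : ℕ) : ℤ) - 3) = ((m : ℕ) : ℤ) := by push_cast; ring
  unfold rayleighQ
  simp only [e1, e2, zpow_natCast]
  rw [← intervalIntegral.integral_const_mul, ← intervalIntegral.integral_add]
  · simp only [mul_assoc]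
  · exact aux_ii_deriv R a K hR hL _ (hh.pow _)
  · exact (aux_ii_sq R a K hR hL _ (hh.pow _)).const_mul _

lemma aux_cs (a : ℝ → ℝ) (K : NNReal) (r : ℝ) (hr : 0 < r)
    (hL : LipschitzOnWith K a (Set.Icc 0 r)) :
    (a r - a 0) ^ 2 ≤ r * ∫ x in (0:ℝ)..r, (deriv a x) ^ 2 := by
  have hac : AbsolutelyContinuousOnInterval a 0 r := by
    apply LipschitzOnWith.absolutelyContinuousOnInterval (K := K)
    rwa [Set.uIcc_of_le hr.le]
  have hI := hac.integral_deriv_eq_sub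
  have hi1 := hac.intervalIntegrable_deriv
  have hi2 : IntervalIntegrable (fun x => (deriv a x) ^ 2) volume 0 r := by
    simpa using aux_ii_deriv r a K hr hL (fun _ => 1) continuousOn_const
  set t := (a r - a 0) / r with ht
  have h0 : 0 ≤ ∫ x in (0:ℝ)..r, (deriv a x - t) ^ 2 :=
    intervalIntegral.integral_nonneg hr.le (fun x _ => sq_nonneg _)
  have h1 : ∫ x in (0:ℝ)..r, (deriv a x - t) ^ 2 =
      (∫ x in (0:ℝ)..r, (deriv a x) ^ 2) - 2 * t * (a r - a 0) + t ^ 2 * r := by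
    have : ∀ x, (deriv a x - t) ^ 2 = ((deriv a x) ^ 2 - 2 * t * deriv a x) + t ^ 2 := by
      intro x; ring
    simp only [this]
    rw [intervalIntegral.integral_add (hi2.sub (hi1.const_mul _)) intervalIntegrable_const,
      intervalIntegral.integral_sub hi2 (hi1.const_mul _),
      intervalIntegral.integral_const_mul, hI]
    simp [mul_comm]
  have h2 : t * r = a r - a 0 := by rw [ht]; field_simp
  rw [h1] at h0
  have := mul_nonneg hr.le h0
  nlinarith

/-- the test function -/
lemma aux_test (R R1 : ℝ) (m : ℕ) (lam : ℝ) (h : ℝ → ℝ) (hR1 : 0 < R1) (hR1R : R1 < R)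
    (hh : ContinuousOn h (Set.Icc 0 R)) (hpos : ∀ r ∈ Set.Icc 0 R, 0 ≤ h r) (hlam : 0 ≤ lam)
    (C2 : ℝ) (hC2 : 0 < C2) (hub : ∀ r ∈ Set.Icc (0:ℝ) R, h r ≤ C2) :
    ∃ b : ℝ → ℝ, (∃ K : NNReal, LipschitzOnWith K b (Set.Icc 0 R)) ∧ b R = 0 ∧ b 0 = 1 ∧
      (∫ r in (0:ℝ)..R, (deriv b r) ^ 2 * h r ^ (m + 2)) ≤ C2 ^ (m + 2) / (R - R1) ∧
      (∫ r in (0:ℝ)..R, (b r) ^ 2 * h r ^ m) ≤ R * C2 ^ m := by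
  have hR : 0 < R := hR1.trans hR1R
  have hd : 0 < R - R1 := sub_pos.2 hR1R
  let b : ℝ → ℝ := fun r => min 1 ((R - r) / (R - R1))
  have hbL : LipschitzOnWith (Real.toNNReal (1 / (R - R1))) b (Set.Icc 0 R) := by
    apply LipschitzWith.lipschitzOnWith
    apply LipschitzWith.const_min
    apply LipschitzWith.of_dist_le_mul
    intro x y
    rw [Real.coe_toNNReal _ (by positivity), Real.dist_eq, Real.dist_eq, ← sub_div,
      abs_div, abs_of_pos hd, show R - x - (R - y) = -(x - y) by ring, abs_neg]
    exact le_of_eq (by ring)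
  have hi := aux_ii_deriv R b _ hR hbL (fun r => h r ^ (m + 2)) (hh.pow _)
  have hi2 := aux_ii_sq R b _ hR hbL (fun r => h r ^ m) (hh.pow _)
  refine ⟨b, ⟨_, hbL⟩, by simp [b], ?_, ?_, ?_⟩
  · have : 1 ≤ (R - 0) / (R - R1) := by rw [le_div_iff₀ hd]; linarith
    simp only [b]; exact min_eq_left this
  · have hA : IntervalIntegrable (fun r => (deriv b r) ^ 2 * h r ^ (m + 2)) volume 0 R1 := by
      apply hi.mono_set
      rw [Set.uIcc_of_le hR1.le, Set.uIcc_of_le hR.le]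
      exact Set.Icc_subset_Icc le_rfl hR1R.le
    have hB : IntervalIntegrable (fun r => (deriv b r) ^ 2 * h r ^ (m + 2)) volume R1 R := by
      apply hi.mono_set
      rw [Set.uIcc_of_le hR1R.le, Set.uIcc_of_le hR.le]
      exact Set.Icc_subset_Icc hR1.le le_rfl
    rw [← intervalIntegral.integral_add_adjacent_intervals hA hB]
    have h1 : ∫ r in (0:ℝ)..R1, (deriv b r) ^ 2 * h r ^ (m + 2) ≤ ∫ r in (0:ℝ)..R1, (0:ℝ) := by
      refine intervalIntegral.integral_mono_on_of_le_Ioo hR1.le hA intervalIntegrable_const ?_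
      intro r hr
      have : b =ᶠ[nhds r] fun _ => 1 := by
        filter_upwards [Iio_mem_nhds hr.2] with x hx
        refine min_eq_left ?_
        rw [le_div_iff₀ hd]; have : x < R1 := hx; linarith
      rw [this.deriv_eq]; simp
    have h2 : ∫ r in R1..R, (deriv b r) ^ 2 * h r ^ (m + 2) ≤
        ∫ r in R1..R, (1 / (R - R1)) ^ 2 * C2 ^ (m + 2) := by
      refine intervalIntegral.integral_mono_on_of_le_Ioo hR1R.le hB intervalIntegrable_const ?_
      intro r hr
      have hr' : r ∈ Set.Icc 0 R := ⟨hR1.le.trans hr.1.le, hr.2.le⟩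
      have hn := norm_deriv_le_of_lipschitzOn (Icc_mem_nhds (hR1.trans hr.1) hr.2) hbL
      rw [Real.coe_toNNReal _ (by positivity), Real.norm_eq_abs] at hn
      have h3 : (deriv b r) ^ 2 ≤ (1 / (R - R1)) ^ 2 := by
        rw [← sq_abs]; gcongr
      have h4 := pow_le_pow_left₀ (hpos r hr') (hub r hr') (m + 2)
      exact mul_le_mul h3 h4 (pow_nonneg (hpos r hr') _) (by positivity)
    have h5 : ∫ r in R1..R, (1 / (R - R1)) ^ 2 * C2 ^ (m + 2) = C2 ^ (m + 2) / (R - R1) := by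
      rw [intervalIntegral.integral_const, smul_eq_mul]; field_simp
    rw [intervalIntegral.integral_zero] at h1
    linarith
  · have : ∫ r in (0:ℝ)..R, (b r) ^ 2 * h r ^ m ≤ ∫ r in (0:ℝ)..R, C2 ^ m := by
      refine intervalIntegral.integral_mono_on hR.le hi2 intervalIntegrable_const ?_
      intro r hr
      have b1 : b r ≤ 1 := min_le_left _ _
      have b0 : 0 ≤ b r := le_min zero_le_one (div_nonneg (by linarith [hr.2]) hd.le)
      have h4 := pow_le_pow_left₀ (hpos r hr) (hub r hr) m
      have h5 : b r ^ 2 ≤ 1 := by nlinarith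
      calc b r ^ 2 * h r ^ m ≤ 1 * C2 ^ m :=
            mul_le_mul h5 h4 (pow_nonneg (hpos r hr) _) zero_le_one
        _ = _ := one_mul _
    simpa using this

set_option maxHeartbeats 2000000 in
theorem stmt_12 (n : ℕ) (hn : 3 ≤ n) (R : ℝ) (hR : 0 < R) (h : ℝ → ℝ)
    (hH : SatisfiesH R h) (k : ℕ) (hk : 1 ≤ k)
    (C1 C2 R1 : ℝ) (hC1 : 0 < C1) (hC12 : C1 < C2) (hR1 : 0 < R1) (hR1R : R1 < R)
    (hub : ∀ r ∈ Set.Icc (0:ℝ) R, h r ≤ C2)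
    (hlb : ∀ r ∈ Set.Icc (0:ℝ) R1, C1 ≤ h r)
    (γ : ℝ) (hγ : 0 < γ)
    (hγρ : γ ≤ 1 / (4 * R1 *
      ((C2 ^ (2 * (n - 2)) / C1 ^ (2 * (n - 1))) *
        (R * (sphereEig n k) ^ 2 + C2 ^ 2 * sphereEig n k / (R - R1)) /
        (sphereEig n (k + 1) - sphereEig n k))))
    (hratio : steklov R n (k + 1) h / steklov R n k h ≥
      sphereEig n (k + 1) / sphereEig n k - γ)
    (a : ℝ → ℝ) (ha : IsMinimizer R n k h a) (ha0 : a 0 = 1) :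
    ∀ r ∈ Set.Ioc (0:ℝ) R1, 1 / 2 ≤ a r ∧ a r ≤ 3 / 2 := by
  obtain ⟨m, rfl⟩ : ∃ m, n = m + 3 := ⟨n - 3, by omega⟩
  obtain ⟨hsm, hp, hhR, -, -⟩ := hH
  have hh : ContinuousOn h (Set.Icc 0 R) := hsm.continuousOn
  have hpos : ∀ r ∈ Set.Icc 0 R, 0 ≤ h r := by
    intro r hr
    rcases hr.2.lt_or_eq with h1 | h1
    · exact (hp r ⟨hr.1, h1⟩).le
    · rw [h1, hhR]
  have hC2 : 0 < C2 := hC1.trans hC12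
  have hd : 0 < R - R1 := sub_pos.2 hR1R
  have hk' : (1:ℝ) ≤ k := by exact_mod_cast hk
  have hm0 : (0:ℝ) ≤ m := Nat.cast_nonneg m
  have hl : 0 < sphereEig (m + 3) k := by
    unfold sphereEig; push_cast; apply mul_pos <;> linarith
  have hlm : 0 < sphereEig (m + 3) (k + 1) - sphereEig (m + 3) k := by
    unfold sphereEig; push_cast; nlinarith
  set l := sphereEig (m + 3) k with hldef
  set μ := sphereEig (m + 3) (k + 1) with hμdef
  obtain ⟨⟨⟨K, hL⟩, haR, ha0'⟩, hmin⟩ := ha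
  set H := h 0 ^ (m + 2) with hHdef
  have hHpos : 0 < H := pow_pos (hp 0 ⟨le_rfl, hR⟩) _
  have hnn : ∀ (lam : ℝ), 0 ≤ lam → ∀ c, IsAdmissible R c →
      0 ≤ rayleighQ R (m + 3) lam h c := by
    rintro lam hlam c ⟨⟨K', hL'⟩, -, -⟩
    rw [aux_rq R m lam h c K' hR hL' hh]
    refine div_nonneg (add_nonneg ?_ (mul_nonneg hlam ?_)) (by positivity)
    · exact intervalIntegral.integral_nonneg hR.le
        (fun r hr => mul_nonneg (sq_nonneg _) (pow_nonneg (hpos r hr) _))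
    · exact intervalIntegral.integral_nonneg hR.le
        (fun r hr => mul_nonneg (sq_nonneg _) (pow_nonneg (hpos r hr) _))
  have hle : ∀ j : ℕ, 0 ≤ sphereEig (m + 3) j → ∀ c, IsAdmissible R c →
      steklov R (m + 3) j h ≤ rayleighQ R (m + 3) (sphereEig (m + 3) j) h c := by
    intro j hj c hc
    refine csInf_le ⟨0, ?_⟩ ⟨c, hc, rfl⟩
    rintro v ⟨c', hc', rfl⟩
    exact hnn _ hj c' hc'
  have hadm : IsAdmissible R a := ⟨⟨K, hL⟩, haR, ha0'⟩
  have hμ : 0 ≤ μ := by linarith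
  have hs1 := hle (k + 1) hμ a hadm
  rw [aux_rq R m _ h a K hR hL hh, ha0, one_pow, one_mul, ← hHdef, ← hμdef] at hs1
  rw [aux_rq R m _ h a K hR hL hh, ha0, one_pow, one_mul, ← hHdef, ← hldef] at hmin
  obtain ⟨b, ⟨Kb, hbL⟩, hbR, hb0, hb1, hb2⟩ :=
    aux_test R R1 m l h hR1 hR1R hh hpos hl.le C2 hC2 hub
  have hs2 := hle k hl.le b ⟨⟨Kb, hbL⟩, hbR, by rw [hb0]; exact one_ne_zero⟩
  rw [aux_rq R m _ h b Kb hR hbL hh, hb0, one_pow, one_mul, ← hHdef, ← hldef] at hs2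
  have hDi := aux_ii_deriv R a K hR hL (fun r => h r ^ (m + 2)) (hh.pow _)
  set D := ∫ r in (0:ℝ)..R, (deriv a r) ^ 2 * h r ^ (m + 2) with hDdef
  set N := ∫ r in (0:ℝ)..R, (a r) ^ 2 * h r ^ m with hNdef
  have hD0 : 0 ≤ D := intervalIntegral.integral_nonneg hR.le
        (fun r hr => mul_nonneg (sq_nonneg _) (pow_nonneg (hpos r hr) _))
  have hN0 : 0 ≤ N := intervalIntegral.integral_nonneg hR.le
        (fun r hr => mul_nonneg (sq_nonneg _) (pow_nonneg (hpos r hr) _))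
  set s := steklov R (m + 3) k h
  set s' := steklov R (m + 3) (k + 1) h
  have hsH : D + l * N = s * H := by rw [← hmin]; field_simp
  rw [le_div_iff₀ hHpos] at hs1 hs2
  have hS : s * H ≤ C2 ^ (m + 2) / (R - R1) + l * (R * C2 ^ m) :=
    hs2.trans (add_le_add hb1 (mul_le_mul_of_nonneg_left hb2 hl.le))
  have hs0 : 0 ≤ s := by
    rw [← hmin]; positivity
  -- the key inequality
  have hkey : (μ - l) * D ≤ γ * l * (s * H) := by
    rcases hs0.eq_or_lt with h0 | h0
    · rw [← h0] at hsH ⊢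
      have : D = 0 := by nlinarith [mul_nonneg hl.le hN0]
      rw [this]; simp
    · rw [ge_iff_le, le_div_iff₀ h0] at hratio
      have h1 : (μ / l - γ) * s * H ≤ D + μ * N :=
        (mul_le_mul_of_nonneg_right hratio hHpos.le).trans hs1
      have h2 : l * ((μ / l - γ) * s * H) = μ * (s * H) - γ * l * (s * H) := by
        field_simp
      have h3 := mul_le_mul_of_nonneg_left h1 hl.le
      rw [h2] at h3
      nlinarith
  set B := R * l ^ 2 + C2 ^ 2 * l / (R - R1) with hB
  have hBpos : 0 < B := by positivity
  have hSB : l * (s * H) ≤ C2 ^ m * B := by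
    have := mul_le_mul_of_nonneg_left hS hl.le
    have e : l * (C2 ^ (m + 2) / (R - R1) + l * (R * C2 ^ m)) = C2 ^ m * B := by
      rw [hB]; field_simp
      ring
    linarith
  have hDB : (μ - l) * D ≤ γ * (C2 ^ m * B) := by
    refine hkey.trans ?_
    rw [mul_assoc]
    exact mul_le_mul_of_nonneg_left hSB hγ.le
  -- R1 * D ≤ C1^(m+2) / 4
  have hfin : 4 * R1 * D ≤ C1 ^ (m + 2) := by
    have e1 : 2 * (m + 3 - 2) = m + (m + 2) := by omega
    have e2 : 2 * (m + 3 - 1) = (m + 2) + (m + 2) := by omega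
    rw [e1, e2, le_div_iff₀ (by positivity), pow_add, pow_add C1] at hγρ
    have hP : 0 < C1 ^ (m + 2) := pow_pos hC1 _
    have hPQ : C1 ^ (m + 2) ≤ C2 ^ (m + 2) := pow_le_pow_left₀ hC1.le hC12.le _
    have hM : 0 < C2 ^ m := pow_pos hC2 _
    generalize C1 ^ (m + 2) = P at *
    generalize C2 ^ (m + 2) = Q at *
    generalize C2 ^ m = M at *
    have h1 : γ * (4 * R1 * (M * Q / (P * P) * B / (μ - l))) =
      (4 * R1 * (γ * (M * B)) * Q) / (P * P * (μ - l)) := by field_simp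
    rw [h1, div_le_one (by positivity)] at hγρ
    have h2 : 4 * R1 * (γ * (M * B)) * P ≤ P * P * (μ - l) :=
      (mul_le_mul_of_nonneg_left hPQ (by positivity)).trans hγρ
    have h3 : 4 * R1 * (γ * (M * B)) ≤ P * (μ - l) := by
      refine le_of_mul_le_mul_right (h2.trans (le_of_eq ?_)) hP
      ring
    have h4 := mul_le_mul_of_nonneg_left hDB (show 0 ≤ 4 * R1 by positivity)
    refine le_of_mul_le_mul_right (le_trans (le_of_eq ?_) (h4.trans h3)) hlm
    ring
  intro r hr
  have hrR : r ≤ R := hr.2.trans hR1R.le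
  have hLr : LipschitzOnWith K a (Set.Icc 0 r) := hL.mono (Set.Icc_subset_Icc le_rfl hrR)
  have hcs := aux_cs a K r hr.1 hLr
  rw [ha0] at hcs
  have hi2 : IntervalIntegrable (fun x => (deriv a x) ^ 2) volume 0 r := by
    simpa using aux_ii_deriv r a K hr.1 hLr (fun _ => 1) continuousOn_const
  have hDr : IntervalIntegrable (fun x => (deriv a x) ^ 2 * h x ^ (m + 2)) volume 0 r := by
    apply hDi.mono_set
    rw [Set.uIcc_of_le hr.1.le, Set.uIcc_of_le hR.le]
    exact Set.Icc_subset_Icc le_rfl hrR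
  have hDr' : IntervalIntegrable (fun x => (deriv a x) ^ 2 * h x ^ (m + 2)) volume r R := by
    apply hDi.mono_set
    rw [Set.uIcc_of_le hrR, Set.uIcc_of_le hR.le]
    exact Set.Icc_subset_Icc hr.1.le le_rfl
  have hc1 : (∫ x in (0:ℝ)..r, (deriv a x) ^ 2) * C1 ^ (m + 2) ≤ D := by
    rw [← intervalIntegral.integral_mul_const, hDdef,
      ← intervalIntegral.integral_add_adjacent_intervals hDr hDr']
    have h1 : ∫ x in (0:ℝ)..r, (deriv a x) ^ 2 * C1 ^ (m + 2) ≤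
        ∫ x in (0:ℝ)..r, (deriv a x) ^ 2 * h x ^ (m + 2) := by
      refine intervalIntegral.integral_mono_on hr.1.le (hi2.mul_const _) hDr ?_
      intro x hx
      exact mul_le_mul_of_nonneg_left
        (pow_le_pow_left₀ hC1.le (hlb x ⟨hx.1, hx.2.trans hr.2⟩) _) (sq_nonneg _)
    have h2 : 0 ≤ ∫ x in r..R, (deriv a x) ^ 2 * h x ^ (m + 2) :=
      intervalIntegral.integral_nonneg hrR
        (fun x hx => mul_nonneg (sq_nonneg _) (pow_nonneg (hpos x ⟨hr.1.le.trans hx.1, hx.2⟩) _))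
    linarith
  have hsq : (a r - 1) ^ 2 ≤ 1 / 4 := by
    have hP : 0 < C1 ^ (m + 2) := pow_pos hC1 _
    have hE : 0 ≤ ∫ x in (0:ℝ)..r, (deriv a x) ^ 2 :=
      intervalIntegral.integral_nonneg hr.1.le (fun x _ => sq_nonneg _)
    generalize (∫ x in (0:ℝ)..r, (deriv a x) ^ 2) = E at *
    generalize C1 ^ (m + 2) = P at *
    have h1 : 4 * R1 * (E * P) ≤ 4 * R1 * D := mul_le_mul_of_nonneg_left hc1 (by positivity)
    have h2 : 4 * R1 * E ≤ 1 := by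
      refine le_of_mul_le_mul_right ?_ hP
      linarith
    have h3 : r * E ≤ R1 * E := mul_le_mul_of_nonneg_right hr.2 hE
    linarith
  constructor <;> nlinarith
end

section
/- Let n ≥ 4 be an integer and let k ≥ 1 be an integer. For every K > 0 there exists a function h satisfying hypotheses (H) such that the Steklov spectral gap satisfies σ_(k+1)(g_h) − σ_(k)(g_h) > K; that is, the spectral gap is unbounded over the class of metrics of revolution on the ball in dimension n ≥ 4. -/
open MeasureTheory Set

lemma lip_deriv_bound {R : ℝ} {C : NNReal} {a : ℝ → ℝ}
    (ha : LipschitzOnWith C a (Set.Icc 0 R)) {r : ℝ} (hr : r ∈ Set.Ioo 0 R) :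
    |deriv a r| ≤ C :=
  norm_deriv_le_of_lipschitzOn (Icc_mem_nhds hr.1 hr.2) ha

lemma intg_deriv {R : ℝ} (hR : 0 < R) {C : NNReal} {a w : ℝ → ℝ}
    (ha : LipschitzOnWith C a (Set.Icc 0 R)) (hw : Continuous w) :
    IntervalIntegrable (fun r => (deriv a r) ^ 2 * w r) volume 0 R := by
  have h1 : IntervalIntegrable (fun r => (C:ℝ) ^ 2 * |w r|) volume 0 R :=
    Continuous.intervalIntegrable (by fun_prop) _ _
  refine h1.mono_fun ?_ ?_
  · exact (((measurable_deriv a).pow_const 2).mul hw.measurable).aestronglyMeasurable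
  · rw [Set.uIoc_of_le hR.le, ← restrict_Ioo_eq_restrict_Ioc]
    filter_upwards [ae_restrict_mem measurableSet_Ioo] with r hr
    have := lip_deriv_bound ha hr
    rw [Real.norm_eq_abs, Real.norm_eq_abs, abs_mul, abs_mul, abs_pow, abs_pow, abs_abs]
    have h2 : |deriv a r| ^ 2 ≤ |(C:ℝ)| ^ 2 :=
      pow_le_pow_left₀ (abs_nonneg _) (this.trans (le_abs_self _)) 2
    exact mul_le_mul_of_nonneg_right h2 (abs_nonneg _)

lemma intg_val {R : ℝ} (hR : 0 < R) {C : NNReal} {a w : ℝ → ℝ}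
    (ha : LipschitzOnWith C a (Set.Icc 0 R)) (hw : Continuous w) :
    IntervalIntegrable (fun r => (a r) ^ 2 * w r) volume 0 R := by
  apply ContinuousOn.intervalIntegrable
  rw [Set.uIcc_of_le hR.le]
  exact (ha.continuousOn.pow 2).mul hw.continuousOn

lemma osc_bound {R : ℝ} (hR : 0 < R) {C : NNReal} {a w : ℝ → ℝ}
    (ha : LipschitzOnWith C a (Set.Icc 0 R)) (hw : Continuous w)
    (hw0 : ∀ r ∈ Set.Icc 0 R, 0 ≤ w r) {x y c E : ℝ} (hx : 0 ≤ x) (hxy : x ≤ y) (hy : y ≤ R)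
    (hc : 0 < c) (hwc : ∀ r ∈ Set.Icc x y, c ≤ w r) (hE : 0 < E)
    (hI : ∫ r in (0:ℝ)..R, (deriv a r) ^ 2 * w r ≤ E) (hs : (y - x) * E ≤ c / 16) :
    |a y - a x| ≤ 1 / 4 := by
  have hac : AbsolutelyContinuousOnInterval a x y := by
    apply LipschitzOnWith.absolutelyContinuousOnInterval (K := C)
    rw [Set.uIcc_of_le hxy]
    exact ha.mono (Set.Icc_subset_Icc hx hy)
  rw [← hac.integral_deriv_eq_sub]
  have hi0 := intg_deriv hR ha hw
  have hi : IntervalIntegrable (fun r => (deriv a r) ^ 2 * w r) volume x y := by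
    apply hi0.mono_set
    rw [Set.uIcc_of_le hxy, Set.uIcc_of_le hR.le]
    exact Set.Icc_subset_Icc hx hy
  have hle : ∫ r in x..y, (deriv a r) ^ 2 * w r ≤ E := by
    refine le_trans ?_ hI
    refine intervalIntegral.integral_mono_interval hx hxy hy ?_ hi0
    filter_upwards [ae_restrict_mem measurableSet_Ioc] with r hr
    exact mul_nonneg (sq_nonneg _) (hw0 r ⟨hr.1.le, hr.2⟩)
  have hd := hac.intervalIntegrable_deriv
  have key : ∫ r in x..y, |deriv a r| ≤
      ∫ r in x..y, ((1 / (8 * E)) * ((deriv a r) ^ 2 * w r) + 2 * E / c) := by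
    refine intervalIntegral.integral_mono_on hxy hd.abs
      ((hi.const_mul _).add intervalIntegrable_const) ?_
    intro r hr
    have h1 := hwc r hr
    have h2 : (1 / (8 * E)) * ((deriv a r) ^ 2 * c) ≤ (1 / (8 * E)) * ((deriv a r) ^ 2 * w r) := by
      gcongr
    refine le_trans ?_ (add_le_add_left h2 _)
    rw [← sq_abs (deriv a r)]
    set d := |deriv a r|
    have : (1 / (8 * E)) * (d ^ 2 * c) + 2 * E / c - d = (d * c - 4 * E) ^ 2 / (8 * E * c) := by
      field_simp
      ring
    have h3 : 0 ≤ (d * c - 4 * E) ^ 2 / (8 * E * c) := by positivity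
    linarith
  rw [intervalIntegral.integral_add (hi.const_mul _) intervalIntegrable_const,
    intervalIntegral.integral_const_mul, intervalIntegral.integral_const, smul_eq_mul] at key
  have k1 : 1 / (8 * E) * ∫ r in x..y, (deriv a r) ^ 2 * w r ≤ 1 / (8 * E) * E := by gcongr
  have k2 : 1 / (8 * E) * E = 1 / 8 := by field_simp
  have k3 : (y - x) * (2 * E / c) ≤ 1 / 8 := by
    rw [← mul_div_assoc, div_le_iff₀ hc]
    linarith
  have := intervalIntegral.abs_integral_le_integral_abs (f := deriv a) (μ := volume) hxy
  linarith

/-- The profile. -/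
noncomputable def prof (R L η : ℝ) (r : ℝ) : ℝ :=
  (R - r) + L * (Real.smoothTransition (r / η) * Real.smoothTransition ((3 * R / 4 - r) / (R / 4)))

lemma prof_contDiff (R L η : ℝ) : ContDiff ℝ (⊤ : ℕ∞) (prof R L η) := by
  unfold prof
  have h1 : ContDiff ℝ (⊤ : ℕ∞) (fun r : ℝ => Real.smoothTransition (r / η)) :=
    Real.smoothTransition.contDiff.comp (by fun_prop)
  have h2 : ContDiff ℝ (⊤ : ℕ∞)
      (fun r : ℝ => Real.smoothTransition ((3 * R / 4 - r) / (R / 4))) :=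
    Real.smoothTransition.contDiff.comp (by fun_prop)
  exact (contDiff_const.sub contDiff_id).add (contDiff_const.mul (h1.mul h2))

lemma prof_ge {R L η : ℝ} (hL : 0 ≤ L) (r : ℝ) : R - r ≤ prof R L η r := by
  unfold prof
  have := Real.smoothTransition.nonneg (r / η)
  have := Real.smoothTransition.nonneg ((3 * R / 4 - r) / (R / 4))
  have : 0 ≤ L * (Real.smoothTransition (r / η) *
    Real.smoothTransition ((3 * R / 4 - r) / (R / 4))) := by positivity
  linarith

lemma prof_le {R L η : ℝ} (hL : 0 ≤ L) (r : ℝ) : prof R L η r ≤ R - r + L := by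
  unfold prof
  have := mul_le_one₀ (Real.smoothTransition.le_one (r / η))
    (Real.smoothTransition.nonneg ((3 * R / 4 - r) / (R / 4)))
    (Real.smoothTransition.le_one ((3 * R / 4 - r) / (R / 4)))
  have := mul_le_mul_of_nonneg_left this hL
  linarith

lemma prof_zero {R L η : ℝ} : prof R L η 0 = R := by
  simp [prof]

lemma prof_mid {R L η : ℝ} (hR : 0 < R) (hη : 0 < η) {r : ℝ} (h1 : η ≤ r) (h2 : r ≤ R / 2) :
    L ≤ prof R L η r := by
  unfold prof
  rw [Real.smoothTransition.one_of_one_le ((one_le_div hη).2 h1),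
    Real.smoothTransition.one_of_one_le ((one_le_div (by positivity)).2 (by linarith))]
  linarith

lemma prof_end {R L η : ℝ} (hR : 0 < R) {r : ℝ} (h1 : 3 * R / 4 ≤ r) :
    prof R L η r = R - r := by
  unfold prof
  rw [Real.smoothTransition.zero_of_nonpos
    (div_nonpos_of_nonpos_of_nonneg (by linarith : 3 * R / 4 - r ≤ 0) (by positivity))]
  simp

lemma prof_H {R L η : ℝ} (hR : 0 < R) (hL : 0 ≤ L) : SatisfiesH R (prof R L η) := by
  have hRmem : R ∈ Set.Icc 0 R := ⟨hR.le, le_rfl⟩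
  have hu : UniqueDiffOn ℝ (Set.Icc 0 R) := uniqueDiffOn_Icc hR
  have hend : prof R L η R = R - R := prof_end hR (by linarith)
  have hev : prof R L η =ᶠ[nhdsWithin R (Set.Icc 0 R)] fun r => R - r := by
    apply Filter.Eventually.filter_mono nhdsWithin_le_nhds
    filter_upwards [lt_mem_nhds (show 3 * R / 4 < R by linarith)] with r hr
    exact prof_end hR hr.le
  refine ⟨(prof_contDiff R L η).contDiffOn, ?_, ?_, ?_, ?_⟩
  · intro r hr
    have := prof_ge (R := R) (η := η) hL r
    have := hr.2
    linarith
  · rw [hend, sub_self]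
  · rw [hev.derivWithin_eq hend, DifferentiableAt.derivWithin (by fun_prop) (hu R hRmem)]
    simp
  · intro k
    rw [hev.iteratedDerivWithin_eq hend]
    rcases k with _ | k
    · simp
    · rw [iteratedDerivWithin_eq_iteratedDeriv hu
        (by fun_prop) hRmem, show 2 * (k + 1) = (2 * k) + 1 + 1 by ring,
        iteratedDeriv_succ', iteratedDeriv_succ']
      have e1 : deriv (fun r : ℝ => R - r) = fun _ => -1 := by ext; simp
      rw [e1]
      simp

lemma rayQ_split {R : ℝ} (hR : 0 < R) (m : ℕ) (lam : ℝ) {C : NNReal} {h a : ℝ → ℝ}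
    (ha : LipschitzOnWith C a (Set.Icc 0 R)) (hh : Continuous h) :
    rayleighQ R (m + 4) lam h a =
      ((∫ r in (0:ℝ)..R, (deriv a r) ^ 2 * h r ^ (m + 3)) +
        lam * ∫ r in (0:ℝ)..R, (a r) ^ 2 * h r ^ (m + 1)) / ((a 0) ^ 2 * h 0 ^ (m + 3)) := by
  unfold rayleighQ
  have e1 : ((m + 4 : ℕ) : ℤ) - 1 = ((m + 3 : ℕ) : ℤ) := by push_cast; ring
  have e2 : ((m + 4 : ℕ) : ℤ) - 3 = ((m + 1 : ℕ) : ℤ) := by push_cast; ring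
  rw [e1, e2]
  simp only [zpow_natCast, mul_assoc]
  have i1 : IntervalIntegrable (fun r => (deriv a r) ^ 2 * h r ^ (m + 3)) volume 0 R :=
    intg_deriv hR ha (hh.pow _)
  have i2 : IntervalIntegrable (fun r => (a r) ^ 2 * h r ^ (m + 1)) volume 0 R :=
    intg_val hR ha (hh.pow _)
  rw [intervalIntegral.integral_add i1 (i2.const_mul _), intervalIntegral.integral_const_mul]

lemma rayQ_scale (R : ℝ) (n : ℕ) (lam : ℝ) (h a : ℝ → ℝ) {c : ℝ} (hc : c ≠ 0) :
    rayleighQ R n lam h (fun r => c * a r) = rayleighQ R n lam h a := by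
  unfold rayleighQ
  have : ∀ r, (deriv (fun r => c * a r) r) ^ 2 * h r ^ ((n : ℤ) - 1)
      + lam * (c * a r) ^ 2 * h r ^ ((n : ℤ) - 3) =
      c ^ 2 * ((deriv a r) ^ 2 * h r ^ ((n : ℤ) - 1) + lam * (a r) ^ 2 * h r ^ ((n : ℤ) - 3)) := by
    intro r
    rw [deriv_const_mul_field']
    ring
  simp only [this]
  rw [intervalIntegral.integral_const_mul, mul_pow, mul_assoc,
    mul_div_mul_left _ _ (pow_ne_zero 2 hc)]

lemma sphereEig_nonneg (m k : ℕ) : 0 ≤ sphereEig (m + 4) k := by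
  unfold sphereEig
  push_cast
  have : (0:ℝ) ≤ m + 4 + k - 2 := by
    have := Nat.cast_nonneg (α := ℝ) m
    have := Nat.cast_nonneg (α := ℝ) k
    linarith
  positivity

lemma sphereEig_gap (m k : ℕ) : sphereEig (m + 4) k + 1 ≤ sphereEig (m + 4) (k + 1) := by
  unfold sphereEig
  push_cast
  have := Nat.cast_nonneg (α := ℝ) m
  have := Nat.cast_nonneg (α := ℝ) k
  nlinarith

lemma rayQ_nonneg {R : ℝ} (hR : 0 < R) (m k : ℕ) {h a : ℝ → ℝ}
    (ha : IsAdmissible R a) (hh : Continuous h) (h0 : ∀ r ∈ Set.Icc 0 R, 0 ≤ h r) :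
    0 ≤ rayleighQ R (m + 4) (sphereEig (m + 4) k) h a := by
  obtain ⟨⟨C, hC⟩, -, -⟩ := ha
  rw [rayQ_split hR m _ hC hh]
  have := sphereEig_nonneg m k
  have h1 : 0 ≤ ∫ r in (0:ℝ)..R, (deriv a r) ^ 2 * h r ^ (m + 3) :=
    intervalIntegral.integral_nonneg hR.le fun r hr =>
      mul_nonneg (sq_nonneg _) (pow_nonneg (h0 r hr) _)
  have h2 : 0 ≤ ∫ r in (0:ℝ)..R, (a r) ^ 2 * h r ^ (m + 1) :=
    intervalIntegral.integral_nonneg hR.le fun r hr =>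
      mul_nonneg (sq_nonneg _) (pow_nonneg (h0 r hr) _)
  have h3 := h0 0 ⟨le_rfl, hR.le⟩
  positivity

lemma steklov_le {R : ℝ} (hR : 0 < R) (m k : ℕ) {h a : ℝ → ℝ}
    (ha : IsAdmissible R a) (hh : Continuous h) (h0 : ∀ r ∈ Set.Icc 0 R, 0 ≤ h r) :
    steklov R (m + 4) k h ≤ rayleighQ R (m + 4) (sphereEig (m + 4) k) h a := by
  apply csInf_le
  · refine ⟨0, ?_⟩
    rintro v ⟨b, hb, rfl⟩
    exact rayQ_nonneg hR m k hb hh h0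
  · exact ⟨a, ha, rfl⟩

/-- Test function. -/
noncomputable def tst (R : ℝ) (r : ℝ) : ℝ := min 1 (4 * (R - r) / R)

lemma tst_lip {R : ℝ} (hR : 0 < R) : LipschitzWith (Real.toNNReal (4 / R)) (tst R) := by
  unfold tst
  apply LipschitzWith.const_min
  apply LipschitzWith.of_dist_le_mul
  intro x y
  rw [Real.coe_toNNReal _ (by positivity), Real.dist_eq, Real.dist_eq,
    show 4 * (R - x) / R - 4 * (R - y) / R = (4 / R) * (y - x) by ring, abs_mul,
    abs_of_pos (by positivity : 0 < 4 / R), abs_sub_comm]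

lemma tst_zero {R : ℝ} (hR : 0 < R) : tst R 0 = 1 := by
  unfold tst
  rw [sub_zero, mul_div_assoc, div_self hR.ne']
  norm_num

lemma tst_adm {R : ℝ} (hR : 0 < R) : IsAdmissible R (tst R) := by
  refine ⟨⟨_, (tst_lip hR).lipschitzOnWith⟩, by simp [tst], ?_⟩
  rw [tst_zero hR]
  norm_num

lemma tst_deriv {R : ℝ} (hR : 0 < R) {r : ℝ} (hr : r < 3 * R / 4) : deriv (tst R) r = 0 := by
  have : tst R =ᶠ[nhds r] fun _ => 1 := by
    filter_upwards [gt_mem_nhds hr] with x hx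
    unfold tst
    apply min_eq_left
    rw [le_div_iff₀ hR]
    linarith
  rw [this.deriv_eq]
  simp

lemma upper {R : ℝ} (hR : 0 < R) {L : ℝ} (hL : 0 ≤ L) (η : ℝ) (m k : ℕ) :
    steklov R (m + 4) k (prof R L η) ≤
      (R * (16 / R ^ 2 * R ^ (m + 3)) + sphereEig (m + 4) k * (R * (R + L) ^ (m + 1)))
        / R ^ (m + 3) := by
  have hcont := (prof_contDiff R L η).continuous
  have hp0 : ∀ r ∈ Set.Icc 0 R, 0 ≤ prof R L η r := fun r hr =>
    le_trans (by linarith [hr.2]) (prof_ge hL r)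
  refine (steklov_le hR m k (tst_adm hR) hcont hp0).trans ?_
  rw [rayQ_split hR m _ (tst_lip hR).lipschitzOnWith hcont, tst_zero hR, prof_zero, one_pow,
    one_mul]
  have hlam := sphereEig_nonneg m k
  have h1 : ∫ r in (0:ℝ)..R, (deriv (tst R) r) ^ 2 * prof R L η r ^ (m + 3) ≤
      ∫ r in (0:ℝ)..R, 16 / R ^ 2 * R ^ (m + 3) := by
    refine intervalIntegral.integral_mono_on hR.le
      (intg_deriv hR (tst_lip hR).lipschitzOnWith (hcont.pow _)) intervalIntegrable_const ?_
    intro r hr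
    rcases lt_or_ge r (3 * R / 4) with h | h
    · rw [tst_deriv hR h]
      simp only [ne_eq, OfNat.ofNat_ne_zero, not_false_eq_true, zero_pow, zero_mul]
      positivity
    · rw [prof_end hR h]
      have hd : |deriv (tst R) r| ≤ 4 / R := by
        have := norm_deriv_le_of_lipschitz (x₀ := r) (tst_lip hR)
        rwa [Real.coe_toNNReal _ (by positivity), Real.norm_eq_abs] at this
      have hd2 : (deriv (tst R) r) ^ 2 ≤ 16 / R ^ 2 := by
        rw [← sq_abs, show 16 / R ^ 2 = (4 / R) ^ 2 by rw [div_pow]; norm_num]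
        exact pow_le_pow_left₀ (abs_nonneg _) hd 2
      have h3 : (R - r) ^ (m + 3) ≤ R ^ (m + 3) :=
        pow_le_pow_left₀ (by linarith [hr.2]) (by linarith [hr.1]) _
      exact mul_le_mul hd2 h3 (pow_nonneg (by linarith [hr.2]) _) (by positivity)
  have h2 : ∫ r in (0:ℝ)..R, (tst R r) ^ 2 * prof R L η r ^ (m + 1) ≤
      ∫ r in (0:ℝ)..R, (R + L) ^ (m + 1) := by
    refine intervalIntegral.integral_mono_on hR.le
      (intg_val hR (tst_lip hR).lipschitzOnWith (hcont.pow _)) intervalIntegrable_const ?_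
    intro r hr
    have ht1 : tst R r ≤ 1 := min_le_left _ _
    have ht0 : 0 ≤ tst R r := le_min zero_le_one
      (div_nonneg (mul_nonneg (by norm_num) (by linarith [hr.2])) hR.le)
    have h3 : prof R L η r ^ (m + 1) ≤ (R + L) ^ (m + 1) :=
      pow_le_pow_left₀ (hp0 r hr) (by linarith [hr.1, prof_le (R := R) (η := η) hL r]) _
    have h4 : (tst R r) ^ 2 ≤ 1 := pow_le_one₀ ht0 ht1
    calc _ ≤ 1 * (R + L) ^ (m + 1) :=
          mul_le_mul h4 h3 (pow_nonneg (hp0 r hr) _) zero_le_one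
      _ = _ := one_mul _
  rw [intervalIntegral.integral_const, smul_eq_mul, sub_zero] at h1 h2
  gcongr

lemma lower {R : ℝ} (hR : 0 < R) {L η : ℝ} (hL : 1 ≤ L) (hη : 0 < η) (hη4 : η ≤ R / 4)
    (m k : ℕ) {K S : ℝ} (hK : 0 < K) (hS : steklov R (m + 4) k (prof R L η) + 2 * K ≤ S)
    (hS0 : 0 < S)
    (c1 : η * (S * R ^ (m + 3)) ≤ (R / 2) ^ (m + 3) / 16)
    (c2 : R * (S * R ^ (m + 3)) ≤ L ^ (m + 3) / 16)
    (c3 : 2 * K * R ^ (m + 3) ≤ R / 16 * L) {b : ℝ → ℝ} (hb : IsAdmissible R b)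
    (hb1 : b 0 = 1) :
    steklov R (m + 4) k (prof R L η) + 2 * K ≤
      rayleighQ R (m + 4) (sphereEig (m + 4) (k + 1)) (prof R L η) b := by
  have hL0 : 0 < L := by linarith
  have hcont := (prof_contDiff R L η).continuous
  have hp0 : ∀ r ∈ Set.Icc 0 R, 0 ≤ prof R L η r := fun r hr =>
    le_trans (by linarith [hr.2]) (prof_ge hL0.le r)
  rcases le_total S (rayleighQ R (m + 4) (sphereEig (m + 4) (k + 1)) (prof R L η) b) with h | h
  · exact hS.trans h
  have hk := steklov_le hR m k hb hcont hp0
  obtain ⟨⟨C, hC⟩, hbR, -⟩ := hb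
  rw [rayQ_split hR m _ hC hcont, hb1, prof_zero, one_pow, one_mul] at h hk ⊢
  have hgap := sphereEig_gap m k
  have hlam := sphereEig_nonneg m k
  have hD : 0 < R ^ (m + 3) := by positivity
  have hB0 : 0 ≤ ∫ r in (0:ℝ)..R, (b r) ^ 2 * prof R L η r ^ (m + 1) :=
    intervalIntegral.integral_nonneg hR.le fun r hr =>
      mul_nonneg (sq_nonneg _) (pow_nonneg (hp0 r hr) _)
  have hA : ∫ r in (0:ℝ)..R, (deriv b r) ^ 2 * prof R L η r ^ (m + 3) ≤ S * R ^ (m + 3) := by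
    rw [div_le_iff₀ hD] at h
    nlinarith [mul_nonneg (by linarith : 0 ≤ sphereEig (m + 4) (k + 1)) hB0]
  have hE : 0 < S * R ^ (m + 3) := by positivity
  have hw0 : ∀ r ∈ Set.Icc 0 R, 0 ≤ prof R L η r ^ (m + 3) := fun r hr => pow_nonneg (hp0 r hr) _
  have o1 : |b η - b 0| ≤ 1 / 4 := by
    refine osc_bound hR hC (hcont.pow (m + 3)) hw0 le_rfl hη.le (by linarith)
      (c := (R / 2) ^ (m + 3)) (by positivity) ?_ hE hA (by rwa [sub_zero])
    intro r hr
    exact pow_le_pow_left₀ (by positivity)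
      (le_trans (by linarith [hr.2]) (prof_ge hL0.le r)) _
  have o2 : ∀ r ∈ Set.Icc η (R / 2), |b r - b η| ≤ 1 / 4 := by
    intro r hr
    refine osc_bound hR hC (hcont.pow (m + 3)) hw0 hη.le hr.1 (by linarith [hr.2])
      (c := L ^ (m + 3)) (by positivity) ?_ hE hA ?_
    · intro x hx
      exact pow_le_pow_left₀ hL0.le (prof_mid hR hη hx.1 (hx.2.trans hr.2)) _
    · refine le_trans ?_ c2
      exact mul_le_mul_of_nonneg_right (by linarith [hr.2]) hE.le
  have hi := intg_val hR hC (hcont.pow (m + 1))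
  have hBL : R / 16 * L ≤ ∫ r in (0:ℝ)..R, (b r) ^ 2 * prof R L η r ^ (m + 1) := by
    calc R / 16 * L ≤ (R / 2 - η) * (L / 4) := by nlinarith
      _ = ∫ r in η..(R / 2), L / 4 := by rw [intervalIntegral.integral_const, smul_eq_mul]
      _ ≤ ∫ r in η..(R / 2), (b r) ^ 2 * prof R L η r ^ (m + 1) := by
        refine intervalIntegral.integral_mono_on (by linarith) intervalIntegrable_const
          (hi.mono_set ?_) ?_
        · rw [Set.uIcc_of_le (by linarith), Set.uIcc_of_le hR.le]
          exact Set.Icc_subset_Icc hη.le (by linarith)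
        · intro r hr
          have := o2 r hr
          rw [hb1] at o1
          rw [abs_le] at o1 this
          have hbr : 1 / 2 ≤ b r := by linarith [o1.1, this.1]
          have hb2 : 1 / 4 ≤ b r ^ 2 := by nlinarith
          have hp : L ≤ prof R L η r ^ (m + 1) := by
            have := prof_mid (L := L) hR hη hr.1 hr.2
            exact this.trans (le_self_pow₀ (hL.trans this) (by omega))
          calc L / 4 = 1 / 4 * L := by ring
            _ ≤ _ := mul_le_mul hb2 hp hL0.le (sq_nonneg _)
      _ ≤ _ := by
        refine intervalIntegral.integral_mono_interval hη.le (by linarith) (by linarith) ?_ hi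
        filter_upwards [ae_restrict_mem measurableSet_Ioc] with r hr
        exact mul_nonneg (sq_nonneg _) (pow_nonneg (hp0 r ⟨hr.1.le, hr.2⟩) _)
  set A := ∫ r in (0:ℝ)..R, (deriv b r) ^ 2 * prof R L η r ^ (m + 3)
  set B := ∫ r in (0:ℝ)..R, (b r) ^ 2 * prof R L η r ^ (m + 1)
  rw [le_div_iff₀ hD] at hk ⊢
  nlinarith

theorem stmt_16 (n : ℕ) (hn : 4 ≤ n) (R : ℝ) (hR : 0 < R) (k : ℕ) (hk : 1 ≤ k) :
    ∀ K : ℝ, 0 < K → ∃ h : ℝ → ℝ, SatisfiesH R h ∧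
      steklov R n (k + 1) h - steklov R n k h > K := by
  intro K hK
  obtain ⟨m, rfl⟩ : ∃ m, n = m + 4 := ⟨n - 4, by omega⟩
  have hlam := sphereEig_nonneg m k
  set lam := sphereEig (m + 4) k with hlamdef
  have hD : 0 < R ^ (m + 3) := by positivity
  set P := R * (16 / R ^ 2 * R ^ (m + 3)) + 2 * K * R ^ (m + 3) with hP
  have hP0 : 0 < P := by positivity
  set Q := P + lam * (R * 2 ^ (m + 1)) with hQ
  have hQ0 : 0 < Q := by positivity
  obtain ⟨L, hL1, hLR, hLQ, hLK⟩ : ∃ L : ℝ, 1 ≤ L ∧ R ≤ L ∧ 16 * R * Q ≤ L ∧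
      2 * K * R ^ (m + 3) / (R / 16) ≤ L := by
    have a1 : 0 < 16 * R * Q := by positivity
    have a2 : 0 < 2 * K * R ^ (m + 3) / (R / 16) := by positivity
    exact ⟨1 + R + 16 * R * Q + 2 * K * R ^ (m + 3) / (R / 16), by linarith, by linarith,
      by linarith, by linarith⟩
  have hL0 : 0 < L := by linarith
  set S := (R * (16 / R ^ 2 * R ^ (m + 3)) + lam * (R * (R + L) ^ (m + 1))) / R ^ (m + 3) + 2 * K
    with hS
  have hS0 : 0 < S := by positivity
  have hSD : S * R ^ (m + 3) = P + lam * (R * (R + L) ^ (m + 1)) := by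
    rw [hS, hP, add_mul, div_mul_cancel₀ _ hD.ne']
    ring
  have hSDle : S * R ^ (m + 3) ≤ Q * L ^ (m + 1) := by
    have h1 : (R + L) ^ (m + 1) ≤ 2 ^ (m + 1) * L ^ (m + 1) := by
      rw [← mul_pow]
      exact pow_le_pow_left₀ (by positivity) (by linarith) _
    have h2 : 1 ≤ L ^ (m + 1) := one_le_pow₀ hL1
    have h3 : lam * (R * (R + L) ^ (m + 1)) ≤ lam * (R * (2 ^ (m + 1) * L ^ (m + 1))) := by
      gcongr
    rw [hSD, hQ]
    nlinarith
  have c2 : R * (S * R ^ (m + 3)) ≤ L ^ (m + 3) / 16 := by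
    have h1 : R * (S * R ^ (m + 3)) ≤ R * (Q * L ^ (m + 1)) := by gcongr
    have h2 : 16 * R * Q ≤ L ^ 2 := by nlinarith
    have h3 : (16 * R * Q) * L ^ (m + 1) ≤ L ^ 2 * L ^ (m + 1) := by gcongr
    have h4 : L ^ (m + 3) = L ^ 2 * L ^ (m + 1) := by ring
    rw [h4]
    linarith
  have c3 : 2 * K * R ^ (m + 3) ≤ R / 16 * L := by
    rw [div_le_iff₀ (by positivity)] at hLK
    linarith
  have hE : 0 < S * R ^ (m + 3) := by positivity
  set η := min (R / 4) ((R / 2) ^ (m + 3) / 16 / (S * R ^ (m + 3))) with hη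
  have hη0 : 0 < η := lt_min (by positivity) (by positivity)
  have hη4 : η ≤ R / 4 := min_le_left _ _
  have c1 : η * (S * R ^ (m + 3)) ≤ (R / 2) ^ (m + 3) / 16 := by
    rw [← le_div_iff₀ hE]
    exact min_le_right _ _
  refine ⟨prof R L η, prof_H hR hL0.le, ?_⟩
  have hup := upper hR hL0.le η m k
  rw [← hlamdef] at hup
  have hfin : steklov R (m + 4) k (prof R L η) + 2 * K ≤
      steklov R (m + 4) (k + 1) (prof R L η) := by
    refine le_csInf ⟨_, tst R, tst_adm hR, rfl⟩ ?_
    rintro v ⟨a, ha, rfl⟩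
    have ha0 : (a 0)⁻¹ ≠ 0 := inv_ne_zero ha.2.2
    rw [← rayQ_scale R (m + 4) _ _ a ha0]
    refine lower hR hL1 hη0 hη4 m k hK (by rw [hS]; linarith) hS0 c1 c2 c3 ?_
      (inv_mul_cancel₀ ha.2.2)
    obtain ⟨⟨C, hC⟩, h1, h2⟩ := ha
    refine ⟨⟨‖(a 0)⁻¹‖₊ * C, ?_⟩, by simp [h1], by simp [h2]⟩
    apply LipschitzOnWith.of_dist_le_mul
    intro x hx y hy
    have := hC.dist_le_mul x hx y hy
    rw [Real.dist_eq] at this ⊢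
    rw [← mul_sub, abs_mul]
    push_cast
    rw [Real.norm_eq_abs, mul_assoc]
    gcongr
  linarith
end
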